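/- For every integer n ≥ 5, the double cover Ã_n of the alternating group is a perfect group: its commutator subgroup is the whole group, ⁅⊤, ⊤⁆ = ⊤. -/

import Mathlib

/-- Relations defining the double cover `S̃ₙ` of the symmetric group:
generators are `none = z` and `some i = tᵢ` for `i : Fin (n-1)`, with relations
`z² = 1`, `tᵢ² = z`, `(tᵢ tᵢ₊₁)³ = z` and `(tᵢ tⱼ)² = z` for `|i - j| ≥ 2`. -/
def spinRels (n : ℕ) : Set (FreeGroup (Option (Fin (n - 1)))) :=
  {r | r = FreeGroup.of (none : Option (Fin (n - 1))) ^ 2}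
  ∪ {r | ∃ i : Fin (n - 1), r = FreeGroup.of (some i) ^ 2 * (FreeGroup.of none)⁻¹}
  ∪ {r | ∃ i j : Fin (n - 1), (j : ℕ) = (i : ℕ) + 1 ∧
      r = (FreeGroup.of (some i) * FreeGroup.of (some j)) ^ 3 * (FreeGroup.of none)⁻¹}
  ∪ {r | ∃ i j : Fin (n - 1), ((i : ℕ) + 2 ≤ (j : ℕ) ∨ (j : ℕ) + 2 ≤ (i : ℕ)) ∧
      r = (FreeGroup.of (some i) * FreeGroup.of (some j)) ^ 2 * (FreeGroup.of none)⁻¹}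

/-- The double cover `S̃ₙ` of the symmetric group, as a presented group. -/
abbrev SpinSym (n : ℕ) : Type := PresentedGroup (spinRels n)

/-- The central element `z` of `S̃ₙ`. -/
def spinZ (n : ℕ) : SpinSym n := PresentedGroup.of none

/-- The generator `tᵢ` of `S̃ₙ`. -/
def spinT (n : ℕ) (i : Fin (n - 1)) : SpinSym n := PresentedGroup.of (some i)

/-- The `i`-th point of `Fin n`, for `i : Fin (n-1)`. -/
def finL {n : ℕ} (i : Fin (n - 1)) : Fin n := ⟨(i : ℕ), by have := i.2; omega⟩

/-- The `(i+1)`-st point of `Fin n`, for `i : Fin (n-1)`. -/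
def finR {n : ℕ} (i : Fin (n - 1)) : Fin n := ⟨(i : ℕ) + 1, by have := i.2; omega⟩

/-- `π : S̃ₙ → Sₙ` is the canonical projection iff `π z = 1` and `π tᵢ` is the
transposition of the `i`-th and `(i+1)`-st points. -/
def IsSpinProj (n : ℕ) (π : SpinSym n →* Equiv.Perm (Fin n)) : Prop :=
  π (spinZ n) = 1 ∧ ∀ i : Fin (n - 1), π (spinT n i) = Equiv.swap (finL i) (finR i)

/-- The double cover `Ãₙ = π⁻¹(Aₙ)` of the alternating group, as a subgroup of `S̃ₙ`. -/
def SpinAlt (n : ℕ) (π : SpinSym n →* Equiv.Perm (Fin n)) : Subgroup (SpinSym n) :=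
  (alternatingGroup (Fin n)).comap π

/-- The central element `z`, as an element of `Ãₙ`. -/
def spinZA (n : ℕ) (π : SpinSym n →* Equiv.Perm (Fin n)) (hπ : IsSpinProj n π) :
    ↥(SpinAlt n π) :=
  ⟨spinZ n, Subgroup.mem_comap.mpr (by rw [hπ.1]; exact Subgroup.one_mem _)⟩

/-- If `a² = c² = z` and `(ca)² = z` with `z` an involution, then `c` and `a` commute
up to `z`. -/
theorem mul_eq_mul_swap_of_sq_eq {G : Type*} [Group G] {z a c : G} (hz : z ^ 2 = 1)
    (ha : a ^ 2 = z) (hc : c ^ 2 = z) (hca : (c * a) ^ 2 = z) : c * a = z * (a * c) := by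
  have hzc : Commute z c := hc ▸ Commute.pow_left rfl 2
  have h : (c * a) * (c * a) = (z * (a * c)) * (c * a) := by
    calc (c * a) * (c * a) = z := by rw [← pow_two, hca]
      _ = z * z ^ 2 := by rw [hz, mul_one]
      _ = z * (a * z * a) := by rw [← ha]; group
      _ = z * (a * c ^ 2 * a) := by rw [hc]
      _ = _ := by simp only [pow_two, mul_assoc]
  exact mul_right_cancel h

/-- Two braided elements coincide when an element commuting with both up to the central
involution has a product with one of them that centralises the 3-cycle `a * b`. -/
theorem eq_of_braid_of_commute {G : Type*} [Group G] {z a b c : G} (hz : z ^ 2 = 1)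
    (ha : a ^ 2 = z) (hb : b ^ 2 = z) (hc : c ^ 2 = z) (hab : (a * b) ^ 3 = z)
    (hca : (c * a) ^ 2 = z) (hcb : (c * b) ^ 2 = z)
    (hcomm : Commute (a * c) (a * b)) : a = b := by
  have h1 := mul_eq_mul_swap_of_sq_eq hz ha hc hca
  have h2 := mul_eq_mul_swap_of_sq_eq hz hb hc hcb
  have hza : Commute z a := ha ▸ Commute.pow_left rfl 2
  have hc_ab : c * (a * b) = a * b * c := by
    calc c * (a * b) = z * a * (c * b) := by rw [← mul_assoc, h1]; simp only [mul_assoc]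
      _ = a * z ^ 2 * b * c := by rw [h2, hza.eq]; simp only [pow_two, mul_assoc]
      _ = a * b * c := by rw [hz, mul_one]
  have hswap : a * b = b * a := by
    have h : a * (a * b) * c = a * (b * a) * c := by
      calc a * (a * b) * c = a * c * (a * b) := by rw [mul_assoc, ← hc_ab, mul_assoc]
        _ = a * b * (a * c) := hcomm
        _ = _ := by simp only [mul_assoc]
    exact mul_left_cancel (mul_right_cancel h)
  have hsq : (a * b) ^ 2 = 1 := by
    rw [Commute.mul_pow hswap, ha, hb, ← pow_two, hz]
  have h : a * b = a * a := by
    rw [← pow_two, ha, ← hab, pow_succ, hsq, one_mul]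
  exact (mul_left_cancel h).symm

theorem spinZ_sq (n : ℕ) : spinZ n ^ 2 = 1 :=
  PresentedGroup.one_of_mem (rels := spinRels n)
    (x := FreeGroup.of (none : Option (Fin (n - 1))) ^ 2) (.inl (.inl (.inl rfl)))

theorem spinT_sq (n : ℕ) (i : Fin (n - 1)) : spinT n i ^ 2 = spinZ n :=
  mul_inv_eq_one.mp <| PresentedGroup.one_of_mem (rels := spinRels n)
    (x := FreeGroup.of (some i) ^ 2 * (FreeGroup.of none)⁻¹) (.inl (.inl (.inr ⟨i, rfl⟩)))

theorem spinT_mul_spinT_pow_three (n : ℕ) {i j : Fin (n - 1)} (h : (j : ℕ) = (i : ℕ) + 1) :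
    (spinT n i * spinT n j) ^ 3 = spinZ n :=
  mul_inv_eq_one.mp <| PresentedGroup.one_of_mem (rels := spinRels n)
    (x := (FreeGroup.of (some i) * FreeGroup.of (some j)) ^ 3 * (FreeGroup.of none)⁻¹)
    (.inl (.inr ⟨i, j, h, rfl⟩))

theorem spinT_mul_spinT_sq (n : ℕ) {i j : Fin (n - 1)}
    (h : (i : ℕ) + 2 ≤ (j : ℕ) ∨ (j : ℕ) + 2 ≤ (i : ℕ)) :
    (spinT n i * spinT n j) ^ 2 = spinZ n :=
  mul_inv_eq_one.mp <| PresentedGroup.one_of_mem (rels := spinRels n)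
    (x := (FreeGroup.of (some i) * FreeGroup.of (some j)) ^ 2 * (FreeGroup.of none)⁻¹)
    (.inr ⟨i, j, h, rfl⟩)

/-- A homomorphism out of `S̃ₙ`, `n ≥ 5`, under which products of two generators commute
kills `z` and identifies all the generators. -/
theorem map_spinZ_eq_one_and_map_spinT_eq {n : ℕ} (hn : 5 ≤ n) {G : Type*} [Group G]
    (f : SpinSym n →* G)
    (hf : ∀ i j k l, Commute (f (spinT n i * spinT n j)) (f (spinT n k * spinT n l))) :
    f (spinZ n) = 1 ∧ ∀ i, f (spinT n i) = f (spinT n ⟨0, by omega⟩) := by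
  have hz : f (spinZ n) ^ 2 = 1 := by rw [← map_pow, spinZ_sq, map_one]
  have ht (i) : f (spinT n i) ^ 2 = f (spinZ n) := by rw [← map_pow, spinT_sq]
  have hbraid {i j : Fin (n - 1)} (h : (j : ℕ) = (i : ℕ) + 1) :
      (f (spinT n i) * f (spinT n j)) ^ 3 = f (spinZ n) := by
    rw [← map_mul, ← map_pow, spinT_mul_spinT_pow_three n h]
  have hfar {i j : Fin (n - 1)} (h : (i : ℕ) + 2 ≤ (j : ℕ) ∨ (j : ℕ) + 2 ≤ (i : ℕ)) :
      (f (spinT n i) * f (spinT n j)) ^ 2 = f (spinZ n) := by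
    rw [← map_mul, ← map_pow, spinT_mul_spinT_sq n h]
  have hadj {i j k : Fin (n - 1)} (hij : (j : ℕ) = (i : ℕ) + 1)
      (hk : (i : ℕ) + 3 ≤ (k : ℕ) ∨ (k : ℕ) + 2 ≤ (i : ℕ)) :
      f (spinT n i) = f (spinT n j) :=
    eq_of_braid_of_commute (c := f (spinT n k)) hz (ht i) (ht j) (ht k) (hbraid hij)
      (hfar (by omega)) (hfar (by omega)) (by simpa only [map_mul] using hf i k i j)
  have h01 : f (spinT n ⟨0, by omega⟩) = f (spinT n ⟨1, by omega⟩) :=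
    hadj (k := ⟨3, by omega⟩) rfl (.inl le_rfl)
  have hsq : (f (spinT n ⟨1, by omega⟩) * f (spinT n ⟨2, by omega⟩)) ^ 2 = f (spinZ n) := by
    rw [← h01]; exact hfar (.inl le_rfl)
  have hcube : (f (spinT n ⟨1, by omega⟩) * f (spinT n ⟨2, by omega⟩)) ^ 3 = f (spinZ n) :=
    hbraid rfl
  have hone : f (spinT n ⟨1, by omega⟩) * f (spinT n ⟨2, by omega⟩) = 1 := by
    rw [pow_succ, hsq] at hcube
    exact mul_eq_left.mp hcube
  have hz1 : f (spinZ n) = 1 := by rw [← hsq, hone, one_pow]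
  have h12 : f (spinT n ⟨1, by omega⟩) = f (spinT n ⟨2, by omega⟩) := by
    refine mul_left_cancel (a := f (spinT n ⟨1, by omega⟩)) ?_
    rw [hone, ← pow_two, ht, hz1]
  refine ⟨hz1, ?_⟩
  rintro ⟨i, hi⟩
  induction i with
  | zero => rfl
  | succ i ih =>
    rw [← ih (by omega)]
    rcases Nat.lt_or_ge i 2 with h | h
    · interval_cases i
      · exact h01.symm
      · exact h12.symm
    · exact (hadj (k := ⟨0, by omega⟩) rfl (.inr (by simpa using h))).symm

theorem sign_map_spinT {n : ℕ} {π : SpinSym n →* Equiv.Perm (Fin n)} (hπ : IsSpinProj n π)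
    (i : Fin (n - 1)) : Equiv.Perm.sign (π (spinT n i)) = -1 := by
  rw [hπ.2, Equiv.Perm.sign_swap]
  simp [finL, finR]

/-- For `n ≥ 5`, the double cover `Ãₙ` of the alternating group is perfect. -/
theorem spinAlt_perfect (n : ℕ) (hn : 5 ≤ n)
    (π : SpinSym n →* Equiv.Perm (Fin n)) (hπ : IsSpinProj n π) :
    commutator ↥(SpinAlt n π) = ⊤ := by
  have : (SpinAlt n π).Normal := Subgroup.normal_comap π
  let f := QuotientGroup.mk' ⁅SpinAlt n π, SpinAlt n π⁆
  have hmem (i j) : spinT n i * spinT n j ∈ SpinAlt n π := by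
    rw [SpinAlt, Subgroup.mem_comap, Equiv.Perm.mem_alternatingGroup]
    simp [sign_map_spinT hπ]
  obtain ⟨hz, ht⟩ := map_spinZ_eq_one_and_map_spinT_eq hn f fun i j k l => by
    rw [← commutatorElement_eq_one_iff_commute, ← map_commutatorElement,
      ← MonoidHom.mem_ker, QuotientGroup.ker_mk']
    exact Subgroup.commutator_mem_commutator (hmem i j) (hmem k l)
  set a := f (spinT n ⟨0, by omega⟩) with ha
  have ha2 : a * a = 1 := by rw [← pow_two, ha, ← map_pow, spinT_sq, hz]
  have key (x : SpinSym n) : (f x = 1 ∧ Equiv.Perm.sign (π x) = 1) ∨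
      (f x = a ∧ Equiv.Perm.sign (π x) = -1) := by
    have hx : x ∈ Subgroup.closure (Set.range (PresentedGroup.of (rels := spinRels n))) := by
      rw [PresentedGroup.closure_range_of]; trivial
    induction hx using Subgroup.closure_induction with
    | mem x hx =>
      obtain ⟨_ | i, rfl⟩ := hx
      · exact .inl ⟨hz, by rw [← spinZ, hπ.1, map_one]⟩
      · exact .inr ⟨ht i, sign_map_spinT hπ i⟩
    | one => simp
    | mul x y _ _ hx hy =>
      rcases hx with ⟨h1, h2⟩ | ⟨h1, h2⟩ <;> rcases hy with ⟨h3, h4⟩ | ⟨h3, h4⟩ <;>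
        simp [h1, h2, h3, h4, ha2]
    | inv x _ hx =>
      rcases hx with ⟨h1, h2⟩ | ⟨h1, h2⟩ <;> simp [h1, h2, inv_eq_of_mul_eq_one_left ha2]
  apply Subgroup.map_injective (SpinAlt n π).subtype_injective
  rw [Subgroup.map_subtype_commutator, ← MonoidHom.range_eq_map, Subgroup.range_subtype]
  refine le_antisymm (Subgroup.commutator_le_self _) fun x hx => ?_
  have hsign : Equiv.Perm.sign (π x) = 1 := Equiv.Perm.mem_alternatingGroup.mp hx
  rcases key x with ⟨h, -⟩ | ⟨-, h⟩
  · rwa [← QuotientGroup.ker_mk' ⁅SpinAlt n π, SpinAlt n π⁆, MonoidHom.mem_ker]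
  · rw [hsign] at h
    exact absurd h (by decide)
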